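/- arXiv:1805.01816 — 2 statements merged into one kernel-verified Lean document; each statement's English description precedes it below -/
import Mathlib

section
/- Fix an integer d ≥ 2 and let K be a perfect and infinite field with char K = 0 or char K > d. Then for every closed subset X of S^d with X ⊊ S^d, there exists an N ∈ ℕ such that for all finite-dimensional K-vector spaces V, every element of X(V) has strength at most N. -/
open MvPolynomial

noncomputable section

/-- A function `F : M → K` on a `K`-vector space `M` is a *polynomial function* if it lies in
the `K`-subalgebra of `M → K` generated by the linear functionals on `M`. -/
def IsPolyFun (K : Type) [Field K] {M : Type} [AddCommGroup M] [Module K M]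
    (F : M → K) : Prop :=
  F ∈ Algebra.adjoin K (Set.range fun l : M →ₗ[K] K => (l : M → K))

/-- A subset of a finite-dimensional `K`-vector space `M` is *Zariski closed* if it is the
common zero locus of a collection of polynomial functions on `M`. -/
def IsZariskiClosed (K : Type) [Field K] {M : Type} [AddCommGroup M] [Module K M]
    (C : Set M) : Prop :=
  ∃ S : Set (M → K), (∀ F ∈ S, IsPolyFun K F) ∧ C = {x | ∀ F ∈ S, F x = 0}

/-- `q ∈ S^d K^n` admits a strength decomposition with exactly `k` terms:
`q = r 0 * s 0 + ⋯ + r (k-1) * s (k-1)` with `r i` homogeneous of degree `e i ∈ {1, …, d-1}`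
and `s i` homogeneous of degree `d - e i`. -/
def HasStrengthDecomp (K : Type) [Field K] (d : ℕ) {n : ℕ}
    (q : MvPolynomial (Fin n) K) (k : ℕ) : Prop :=
  ∃ (e : Fin k → ℕ) (r s : Fin k → MvPolynomial (Fin n) K),
    (∀ i, 1 ≤ e i) ∧ (∀ i, e i ≤ d - 1) ∧
    (∀ i, (r i).IsHomogeneous (e i)) ∧
    (∀ i, (s i).IsHomogeneous (d - e i)) ∧
    q = ∑ i, r i * s i

/-- The strength of `q ∈ S^d K^n` is at most `N`. -/
def StrengthLe (K : Type) [Field K] (d : ℕ) {n : ℕ}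
    (q : MvPolynomial (Fin n) K) (N : ℕ) : Prop :=
  ∃ k ≤ N, HasStrengthDecomp K d q k

/-- The algebra homomorphism `S φ : Sym(K^n) → Sym(K^m)` induced by a linear map
`φ : K^n → K^m`; it restricts to `S^d φ : S^d K^n → S^d K^m` in each degree. -/
def polyMapAlg (K : Type) [Field K] {n m : ℕ} (φ : (Fin n → K) →ₗ[K] (Fin m → K)) :
    MvPolynomial (Fin n) K →ₐ[K] MvPolynomial (Fin m) K :=
  aeval fun i => ∑ j, φ (Pi.single i 1) j • X j

/-- A closed subset `X` of the functor `S^d` over `K`: a rule assigning to each `n` (that is,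
to the vector space `K^n`) a subset `X(K^n) ⊆ S^d K^n` (where `S^d K^n` is the space of
homogeneous polynomials of degree `d` in `n` variables), which is Zariski closed in `S^d K^n`
and such that for every linear map `φ : K^n → K^m` the induced map `S^d φ` maps `X(K^n)`
into `X(K^m)`. -/
structure ClosedSubsetSd (K : Type) [Field K] (d : ℕ) where
  carrier : ∀ n : ℕ, Set (MvPolynomial (Fin n) K)
  homog : ∀ n, ∀ q ∈ carrier n, q.IsHomogeneous d
  closed : ∀ n, IsZariskiClosed K
    {q : homogeneousSubmodule (Fin n) K d | (q : MvPolynomial (Fin n) K) ∈ carrier n}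
  map_mem : ∀ {n m : ℕ} (φ : (Fin n → K) →ₗ[K] (Fin m → K)),
    ∀ q ∈ carrier n, polyMapAlg K φ q ∈ carrier m

section Strength

variable {K : Type} [Field K] {d n : ℕ}

theorem StrengthLe.mono {q : MvPolynomial (Fin n) K} {M N : ℕ} (h : StrengthLe K d q M)
    (hMN : M ≤ N) : StrengthLe K d q N := by
  obtain ⟨k, hk, h⟩ := h
  exact ⟨k, hk.trans hMN, h⟩

theorem strengthLe_zero (N : ℕ) : StrengthLe K d (0 : MvPolynomial (Fin n) K) N :=
  ⟨0, N.zero_le, Fin.elim0, Fin.elim0, Fin.elim0, fun i => i.elim0, fun i => i.elim0,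
    fun i => i.elim0, fun i => i.elim0, by simp⟩

theorem StrengthLe.add {p q : MvPolynomial (Fin n) K} {M N : ℕ} (hp : StrengthLe K d p M)
    (hq : StrengthLe K d q N) : StrengthLe K d (p + q) (M + N) := by
  obtain ⟨k, hk, e, r, s, h1, h2, h3, h4, rfl⟩ := hp
  obtain ⟨k', hk', e', r', s', h1', h2', h3', h4', rfl⟩ := hq
  refine ⟨k + k', by omega, Fin.append e e', Fin.append r r', Fin.append s s', ?_, ?_, ?_, ?_, ?_⟩
  any_goals intro i; refine Fin.addCases (fun i => ?_) (fun i => ?_) i <;> simp [*]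
  simp [Fin.sum_univ_add]

theorem StrengthLe.C_mul {q : MvPolynomial (Fin n) K} {N : ℕ} (c : K)
    (hq : StrengthLe K d q N) : StrengthLe K d (C c * q) N := by
  obtain ⟨k, hk, e, r, s, h1, h2, h3, h4, rfl⟩ := hq
  refine ⟨k, hk, e, fun i => C c * r i, s, h1, h2, fun i => (h3 i).C_mul c, h4, ?_⟩
  simp [Finset.mul_sum, mul_assoc]

theorem strengthLe_mul {r s : MvPolynomial (Fin n) K} {i j : ℕ} (hr : r.IsHomogeneous i)
    (hs : s.IsHomogeneous j) (hi : i ≠ 0) (hj : j ≠ 0) (hij : i + j = d) :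
    StrengthLe K d (r * s) 1 :=
  ⟨1, le_rfl, fun _ => i, fun _ => r, fun _ => s, fun _ => Nat.one_le_iff_ne_zero.2 hi,
    fun _ => by dsimp only; omega, fun _ => hr,
    fun _ => by rwa [← hij, Nat.add_sub_cancel_left], by simp⟩

theorem strengthLe_sum {ι : Type*} (S : Finset ι) (q : ι → MvPolynomial (Fin n) K)
    (h : ∀ i ∈ S, StrengthLe K d (q i) 1) : StrengthLe K d (∑ i ∈ S, q i) S.card := by
  classical
  induction S using Finset.induction_on with
  | empty => simpa using strengthLe_zero 0
  | insert a S ha ih =>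
    rw [Finset.sum_insert ha, Finset.card_insert_of_notMem ha, add_comm S.card]
    exact (h a (by simp)).add (ih fun i hi => h i (by simp [hi]))

end Strength

theorem homogeneousComponent_mul {σ R : Type*} [CommSemiring R] (n : ℕ)
    (f g : MvPolynomial σ R) :
    homogeneousComponent n (f * g) =
      ∑ x ∈ Finset.HasAntidiagonal.antidiagonal n,
        homogeneousComponent x.1 f * homogeneousComponent x.2 g := by
  classical
  ext s
  simp only [coeff_homogeneousComponent, coeff_sum, coeff_mul]
  rw [Finset.sum_comm]
  split_ifs with hs
  · refine Finset.sum_congr rfl fun x hx => ?_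
    rw [Finset.HasAntidiagonal.mem_antidiagonal] at hx
    rw [Finset.sum_eq_single (x.1.degree, x.2.degree)]
    · simp
    · intro y _ hy
      by_cases h1 : x.1.degree = y.1
      · have h2 : x.2.degree ≠ y.2 := fun h2 => hy (Prod.ext h1.symm h2.symm)
        simp [h2]
      · simp [h1]
    · intro h
      refine absurd ?_ h
      rw [Finset.HasAntidiagonal.mem_antidiagonal, ← hs, ← hx, map_add]
  · symm
    refine Finset.sum_eq_zero fun x hx => Finset.sum_eq_zero fun y hy => ?_
    rw [Finset.HasAntidiagonal.mem_antidiagonal] at hx hy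
    by_cases h1 : x.1.degree = y.1
    · have h2 : x.2.degree ≠ y.2 := fun h2 => hs (by rw [← hx, map_add, h1, h2, hy])
      simp [h2]
    · simp [h1]

theorem strengthLe_homogeneousComponent_mul_sub {K : Type} [Field K] {d n : ℕ} (hd : d ≠ 0)
    (f g : MvPolynomial (Fin n) K) :
    StrengthLe K d (homogeneousComponent d (f * g) -
      (C (constantCoeff f) * homogeneousComponent d g +
        C (constantCoeff g) * homogeneousComponent d f)) (d + 1) := by
  classical
  have h0 : (0, d) ∈ Finset.HasAntidiagonal.antidiagonal d := by simp
  have h1 : (d, 0) ∈ (Finset.HasAntidiagonal.antidiagonal d).erase (0, d) := by simp [hd]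
  rw [homogeneousComponent_mul, ← Finset.add_sum_erase _ _ h0, ← Finset.add_sum_erase _ _ h1]
  have key := strengthLe_sum (K := K) (d := d)
    (((Finset.HasAntidiagonal.antidiagonal d).erase (0, d)).erase (d, 0))
    (fun x => homogeneousComponent x.1 f * homogeneousComponent x.2 g) (by
      rintro ⟨i, j⟩ hx
      simp only [Finset.mem_erase, Finset.HasAntidiagonal.mem_antidiagonal, ne_eq,
        Prod.mk.injEq] at hx
      exact strengthLe_mul (homogeneousComponent_isHomogeneous _ _)
        (homogeneousComponent_isHomogeneous _ _) (by dsimp only; omega)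
        (by dsimp only; omega) hx.2.2)
  have hcard : (((Finset.HasAntidiagonal.antidiagonal d).erase (0, d)).erase (d, 0)).card ≤ d + 1 :=
    ((Finset.card_erase_le).trans Finset.card_erase_le).trans (by simp)
  convert key.mono hcard using 1
  simp only [homogeneousComponent_zero, constantCoeff_eq]
  ring

/-- The derivative in the constant direction `c`. -/
abbrev constDerivation {K : Type} [Field K] {ι : Type*} (c : ι → K) :
    Derivation K (MvPolynomial ι K) (MvPolynomial ι K) :=
  mkDerivation K fun i => C (c i)

theorem strengthLe_homogeneousComponent_aeval_sub {K : Type} [Field K] {d : ℕ} (hd : d ≠ 0)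
    {ι : Type*} (c : ι → K) (f : MvPolynomial ι K) :
    ∃ N : ℕ, ∀ (n : ℕ) (q : MvPolynomial (Fin n) K) (G : ι → MvPolynomial (Fin n) K),
      (∀ i, homogeneousComponent d (G i) = C (c i) * q) →
      StrengthLe K d (homogeneousComponent d (aeval G f) -
        C (eval (fun i => constantCoeff (G i)) (constDerivation c f)) * q) N := by
  induction f using MvPolynomial.induction_on with
  | C a =>
    refine ⟨0, fun n q G _ => ?_⟩
    have : homogeneousComponent d (C a : MvPolynomial (Fin n) K) = 0 :=
      homogeneousComponent_eq_zero _ _ (by simpa using Nat.pos_of_ne_zero hd)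
    have hD : constDerivation c (C a) = 0 :=
      Derivation.map_algebraMap _ a
    simpa [algebraMap_eq, this, hD] using strengthLe_zero 0
  | add f g hf hg =>
    obtain ⟨M, hM⟩ := hf
    obtain ⟨N, hN⟩ := hg
    refine ⟨M + N, fun n q G hG => ?_⟩
    convert (hM n q G hG).add (hN n q G hG) using 1
    simp only [map_add]
    ring
  | mul_X f i hf =>
    obtain ⟨N, hN⟩ := hf
    refine ⟨d + 1 + N, fun n q G hG => ?_⟩
    convert (strengthLe_homogeneousComponent_mul_sub hd (aeval G f) (G i)).add
      ((hN n q G hG).C_mul (constantCoeff (G i))) using 1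
    have h : constantCoeff (aeval G f) = eval (fun i => constantCoeff (G i)) f := by
      clear hN
      induction f using MvPolynomial.induction_on <;> simp_all
    rw [h, hG]
    simp only [Derivation.leibniz, mkDerivation_X, smul_eq_mul, map_add, map_mul, aeval_X, eval_X,
      eval_C]
    ring

section Pencil

variable {K : Type} [Field K] {n m : ℕ}

/-- The polynomial `q` evaluated at the generic member `φ + ℓ ⊗ u` of a family of linear maps,
where `ℓ` ranges over the dual space, whose coordinates are the variables of the coefficient
ring. -/
def pencil (φ : (Fin n → K) →ₗ[K] (Fin m → K)) (u : MvPolynomial (Fin m) K) :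
    MvPolynomial (Fin n) K →ₐ[K] MvPolynomial (Fin m) (MvPolynomial (Fin n) K) :=
  aeval fun i => map C (∑ j, φ (Pi.single i 1) j • X j) + C (X i) * map C u

theorem map_eval_pencil (φ : (Fin n → K) →ₗ[K] (Fin m → K)) (w : Fin m → K) (l : Fin n → K)
    (q : MvPolynomial (Fin n) K) :
    map (eval l) (pencil φ (∑ j, w j • X j) q) =
      polyMapAlg K (φ + (Fintype.linearCombination K l).smulRight w) q := by
  have hC : (eval l).comp (C : K →+* MvPolynomial (Fin n) K) = RingHom.id K := by ext; simp
  induction q using MvPolynomial.induction_on with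
  | C a => simp [pencil, polyMapAlg, algebraMap_eq, IsScalarTower.algebraMap_apply K
      (MvPolynomial (Fin n) K) (MvPolynomial (Fin m) (MvPolynomial (Fin n) K))]
  | add p q hp hq => simp only [map_add, hp, hq]
  | mul_X p i hp =>
    rw [map_mul, map_mul, hp, map_mul]
    congr 1
    simp only [pencil, polyMapAlg, aeval_X, map_add, map_mul, map_map, hC, map_id, map_C, eval_X]
    simp [add_smul, Finset.sum_add_distrib, Finset.mul_sum, smul_eq_C_mul, mul_assoc]

/-- `g` has degree at most `e` in the variables of its coefficient ring, with top-degree part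
`p * u ^ e`. -/
def HasTopPart (u : MvPolynomial (Fin m) K) (e : ℕ) (p : MvPolynomial (Fin n) K)
    (g : MvPolynomial (Fin m) (MvPolynomial (Fin n) K)) : Prop :=
  ∀ s, (∀ k, e < k → homogeneousComponent k (coeff s g) = 0) ∧
    homogeneousComponent e (coeff s g) = C (coeff s (u ^ e)) * p

theorem HasTopPart.mul {u : MvPolynomial (Fin m) K} {e e' : ℕ} {p p' : MvPolynomial (Fin n) K}
    {g g' : MvPolynomial (Fin m) (MvPolynomial (Fin n) K)} (h : HasTopPart u e p g)
    (h' : HasTopPart u e' p' g') : HasTopPart u (e + e') (p * p') (g * g') := by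
  classical
  refine fun s => ⟨fun k hk => ?_, ?_⟩
  · rw [coeff_mul, map_sum]
    refine Finset.sum_eq_zero fun x _ => ?_
    rw [homogeneousComponent_mul]
    refine Finset.sum_eq_zero fun y hy => ?_
    rw [Finset.HasAntidiagonal.mem_antidiagonal] at hy
    rcases lt_or_ge e y.1 with h1 | h1
    · rw [(h _).1 _ h1, zero_mul]
    · rw [(h' _).1 y.2 (by omega), mul_zero]
  · rw [coeff_mul, map_sum, pow_add, coeff_mul, map_sum, Finset.sum_mul]
    refine Finset.sum_congr rfl fun x _ => ?_
    rw [homogeneousComponent_mul, Finset.sum_eq_single (e, e')]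
    · rw [(h _).2, (h' _).2, C_mul]
      ring
    · intro y hy hne
      rw [Finset.HasAntidiagonal.mem_antidiagonal] at hy
      rcases lt_or_ge e y.1 with h1 | h1
      · rw [(h _).1 _ h1, zero_mul]
      · have : y.1 ≠ e := fun h2 => hne (Prod.ext h2 (by dsimp only; omega))
        rw [(h' _).1 y.2 (by omega), mul_zero]
    · simp

theorem hasTopPart_one (u : MvPolynomial (Fin m) K) :
    HasTopPart u 0 (1 : MvPolynomial (Fin n) K) 1 := by
  classical
  intro s
  have h : coeff s (1 : MvPolynomial (Fin m) (MvPolynomial (Fin n) K)) =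
      C (coeff s (1 : MvPolynomial (Fin m) K)) := by
    simp only [coeff_one]
    split_ifs <;> simp
  rw [h]
  exact ⟨fun k hk => homogeneousComponent_eq_zero _ _ (by simpa using hk), by simp⟩

theorem hasTopPart_pencil_X (φ : (Fin n → K) →ₗ[K] (Fin m → K)) (u : MvPolynomial (Fin m) K)
    (i : Fin n) : HasTopPart u 1 (X i) (pencil φ u (X i)) := by
  intro s
  set y : MvPolynomial (Fin m) K := ∑ j, φ (Pi.single i 1) j • X j
  have h : coeff s (pencil φ u (X i)) = C (coeff s y) + C (coeff s u) * X i := by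
    simp only [pencil, aeval_X, coeff_add, coeff_C_mul, coeff_map]
    ring
  have hC : ∀ k, 0 < k → homogeneousComponent k (C (coeff s y) : MvPolynomial (Fin n) K) = 0 :=
    fun k hk => homogeneousComponent_eq_zero _ _ (by simpa using hk)
  have hX := fun k => homogeneousComponent_of_mem (m := k) (isHomogeneous_X K i)
  refine ⟨fun k hk => ?_, ?_⟩
  · rw [h, map_add, hC k (by omega), homogeneousComponent_C_mul, hX, if_neg (by omega)]
    simp
  · rw [h, map_add, hC 1 one_pos, homogeneousComponent_C_mul, hX, if_pos rfl, pow_one, zero_add]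

theorem hasTopPart_pencil_monomial (φ : (Fin n → K) →ₗ[K] (Fin m → K))
    (u : MvPolynomial (Fin m) K) (t : Fin n →₀ ℕ) :
    HasTopPart u t.degree (monomial t 1) (pencil φ u (monomial t 1)) := by
  induction t using Finsupp.induction_linear with
  | zero => simpa using hasTopPart_one u
  | add s t hs ht =>
    rw [← mul_one (1 : K), ← monomial_mul, map_mul, map_add]
    exact hs.mul ht
  | single i k =>
    rw [Finsupp.degree_single]
    induction k with
    | zero => simpa using hasTopPart_one u
    | succ k ih =>
      rw [Finsupp.single_add, ← mul_one (1 : K), ← monomial_mul, map_mul]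
      exact ih.mul (hasTopPart_pencil_X φ u i)

theorem homogeneousComponent_coeff_pencil (φ : (Fin n → K) →ₗ[K] (Fin m → K))
    (u : MvPolynomial (Fin m) K) {d : ℕ} {q : MvPolynomial (Fin n) K} (hq : q.IsHomogeneous d)
    (s : Fin m →₀ ℕ) :
    homogeneousComponent d (coeff s (pencil φ u q)) = C (coeff s (u ^ d)) * q := by
  conv_lhs => rw [q.as_sum]
  conv_rhs => rw [q.as_sum]
  rw [map_sum, coeff_sum, map_sum, Finset.mul_sum]
  refine Finset.sum_congr rfl fun t ht => ?_
  have hdeg : t.degree = d := by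
    rw [Finsupp.degree_eq_weight_one]
    exact hq (mem_support_iff.1 ht)
  have ht1 : monomial t (coeff t q) = coeff t q • monomial t (1 : K) := by
    rw [smul_monomial, smul_eq_mul, mul_one]
  rw [ht1, map_smul, coeff_smul, map_smul, ← hdeg, (hasTopPart_pencil_monomial φ u t s).2,
    mul_smul_comm]

end Pencil

section Derivation

variable {K : Type} [Field K] {ι : Type*}

theorem coeff_constDerivation [Fintype ι] (c : ι → K) (f : MvPolynomial ι K) (s : ι →₀ ℕ) :
    coeff s (constDerivation c f) = ∑ i, c i * coeff s (pderiv i f) := by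
  classical
  have hsum (g : MvPolynomial ι K) :
      (∑ i, (C (c i) : MvPolynomial ι K) • pderiv i) g = ∑ i, C (c i) * pderiv i g := by
    change Derivation.coeFnAddMonoidHom (∑ i, (C (c i) : MvPolynomial ι K) • pderiv i) g = _
    rw [map_sum, Finset.sum_apply]
    rfl
  have h : constDerivation c =
      ∑ i, (C (c i) : MvPolynomial ι K) • pderiv i := by
    refine derivation_ext fun i => ?_
    rw [mkDerivation_X, hsum]
    simp [pderiv_X, Pi.single_apply]
  rw [h, hsum]
  simp [coeff_sum, coeff_C_mul]

theorem totalDegree_constDerivation_lt [Fintype ι] (c : ι → K) (f : MvPolynomial ι K)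
    (h : constDerivation c f ≠ 0) :
    (constDerivation c f).totalDegree < f.totalDegree := by
  have key : ∀ s ∈ (constDerivation c f).support, s.degree < f.totalDegree := by
    intro s hs
    rw [mem_support_iff, coeff_constDerivation] at hs
    obtain ⟨i, -, hi⟩ := Finset.exists_ne_zero_of_sum_ne_zero hs
    rw [coeff_pderiv] at hi
    have h1 := le_totalDegree (mem_support_iff.2 (left_ne_zero_of_mul (right_ne_zero_of_mul hi)))
    have h2 : (s + Finsupp.single i 1).degree ≤ f.totalDegree := h1
    rw [map_add, Finsupp.degree_single] at h2
    omega
  obtain ⟨s, hs⟩ := support_nonempty.2 h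
  rw [totalDegree, Finset.sup_lt_iff (lt_of_le_of_lt (Nat.zero_le _) (key s hs))]
  exact key

theorem exists_pow_of_pderiv_eq_zero (p : ℕ) [ExpChar K p] [CharP K p] [PerfectField K]
    (f : MvPolynomial ι K) (hf : ∀ i, pderiv i f = 0) : ∃ g : MvPolynomial ι K, f = g ^ p := by
  classical
  have hp : p ≠ 0 := expChar_ne_zero K p
  have hdvd : ∀ s ∈ f.support, ∀ i, p ∣ s i := by
    intro s hs i
    by_contra hsi
    have hpos : 1 ≤ s i := Nat.one_le_iff_ne_zero.2 fun h => hsi (by simp [h])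
    have h := coeff_pderiv (i := i) f (s - Finsupp.single i 1)
    have hs' : s - Finsupp.single i 1 + Finsupp.single i 1 = s :=
      tsub_add_cancel_of_le (Finsupp.single_le_iff.2 hpos)
    rw [hf, coeff_zero, hs', Finsupp.tsub_apply, Finsupp.single_eq_same] at h
    have h' : ((s i : ℕ) : K) = 0 := by
      have := (mul_eq_zero.1 h.symm).resolve_left (mem_support_iff.1 hs)
      exact_mod_cast (by push_cast [hpos] at this ⊢; simpa using this)
    exact hsi ((CharP.cast_eq_zero_iff K p _).1 h')
  have : PerfectRing K p := PerfectField.toPerfectRing p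
  choose r hr using fun a : K => surjective_frobenius K p a
  refine ⟨∑ s ∈ f.support, monomial (s.mapRange (· / p) (by simp)) (r (coeff s f)), ?_⟩
  conv_lhs => rw [f.as_sum]
  rw [← frobenius_def, map_sum]
  refine Finset.sum_congr rfl fun s hs => ?_
  rw [frobenius_def, monomial_pow, ← frobenius_def, hr]
  refine congrArg (fun t => (monomial t (coeff s f) : MvPolynomial ι K)) (Finsupp.ext fun i => ?_)
  simp [Nat.mul_div_cancel' (hdvd s hs i)]

theorem totalDegree_eq_zero_of_pderiv_eq_zero [CharZero K] (f : MvPolynomial ι K)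
    (hf : ∀ i, pderiv i f = 0) :
    f.totalDegree = 0 := by
  rw [totalDegree_eq_zero_iff]
  intro s hs i
  by_contra hsi
  have h := coeff_pderiv (i := i) f (s - Finsupp.single i 1)
  have hs' : s - Finsupp.single i 1 + Finsupp.single i 1 = s :=
    tsub_add_cancel_of_le (Finsupp.single_le_iff.2 (Nat.one_le_iff_ne_zero.2 hsi))
  rw [hf, coeff_zero, hs'] at h
  have := (mul_eq_zero.1 h.symm).resolve_left (mem_support_iff.1 hs)
  exact Nat.cast_add_one_ne_zero _ this

end Derivation

theorem finite_degree_eq (m d : ℕ) :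
    Finite {s : Fin m →₀ ℕ // s.degree = d} := by
  classical
  refine Set.Finite.subset ((Finset.univ : Finset (Fin m)).finsuppAntidiag d).finite_toSet ?_
  intro s hs
  simp only [Finset.mem_coe, Finset.mem_finsuppAntidiag, Finset.subset_univ, and_true]
  rw [← (show s.degree = d from hs), Finsupp.degree_eq_sum]

/-- The coordinates of a degree `d` polynomial. -/
def coords {K : Type} [Field K] {m : ℕ} (d : ℕ) (q : MvPolynomial (Fin m) K) :
    {s : Fin m →₀ ℕ // s.degree = d} → K :=
  fun s => coeff s.1 q

theorem natCast_multinomial_ne_zero {K : Type} [Field K] {d m : ℕ}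
    (hchar : ringChar K = 0 ∨ d < ringChar K) {s : Fin m →₀ ℕ} (hs : s.degree = d) :
    (s.multinomial : K) ≠ 0 := by
  have hdvd : s.multinomial ∣ d.factorial := by
    have := Nat.multinomial_spec s.support s
    rw [← Finsupp.multinomial_eq] at this
    rw [← hs]
    exact ⟨_, (mul_comm _ _).trans this |>.symm⟩
  have hfac : (d.factorial : K) ≠ 0 := by
    rw [Ne, CharP.cast_eq_zero_iff K (ringChar K)]
    rcases hchar with h | h
    · rw [h, zero_dvd_iff]
      exact d.factorial_ne_zero
    · have hp : (ringChar K).Prime :=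
        (CharP.char_is_prime_or_zero K (ringChar K)).resolve_right (by omega)
      rw [hp.dvd_factorial]
      omega
  obtain ⟨k, hk⟩ := hdvd
  intro h
  rw [hk, Nat.cast_mul, h, zero_mul] at hfac
  exact hfac rfl

theorem exists_constDerivation_coords_pow_ne_zero {K : Type} [Field K] [Infinite K] {d m : ℕ}
    (hchar : ringChar K = 0 ∨ d < ringChar K)
    (f : MvPolynomial {s : Fin m →₀ ℕ // s.degree = d} K) (hf : ∃ i, pderiv i f ≠ 0) :
    ∃ w : Fin m → K,
      constDerivation (coords d ((∑ j, w j • X j : MvPolynomial (Fin m) K) ^ d)) f ≠ 0 := by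
  classical
  have := finite_degree_eq m d
  have := Fintype.ofFinite {s : Fin m →₀ ℕ // s.degree = d}
  obtain ⟨i, hi⟩ := hf
  obtain ⟨t, ht⟩ := ne_zero_iff.1 hi
  by_contra! hall
  set P : MvPolynomial (Fin m) K := ∑ a : {s : Fin m →₀ ℕ // s.degree = d},
    monomial a.1 ((a.1.multinomial : K) * coeff t (pderiv a f)) with hP
  have hP0 : P = 0 := by
    refine MvPolynomial.funext fun w => ?_
    have h := congrArg (coeff t) (hall w)
    rw [coeff_constDerivation, coeff_zero] at h
    rw [map_zero, ← h, hP, map_sum]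
    refine Finset.sum_congr rfl fun a _ => ?_
    rw [eval_monomial, coords, coeff_linearCombination_X_pow_of_fintype, if_pos]
    · ring
    · exact a.2
  have hc := congrArg (coeff i.1) hP0
  rw [hP, coeff_sum, Finset.sum_eq_single i] at hc
  · rw [coeff_monomial, if_pos rfl, coeff_zero] at hc
    exact (mul_ne_zero (natCast_multinomial_ne_zero hchar i.2) ht) hc
  · intro b _ hb
    rw [coeff_monomial, if_neg fun h => hb (Subtype.ext h)]
  · simp

theorem exists_eval_coords_of_isPolyFun {K : Type} [Field K] {d m : ℕ}
    {F : homogeneousSubmodule (Fin m) K d → K} (hF : IsPolyFun K F) :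
    ∃ f : MvPolynomial {s : Fin m →₀ ℕ // s.degree = d} K,
      ∀ q, F q = eval (coords d q.1) f := by
  classical
  have := finite_degree_eq m d
  have := Fintype.ofFinite {s : Fin m →₀ ℕ // s.degree = d}
  unfold IsPolyFun at hF
  induction hF using Algebra.adjoin_induction with
  | mem F hF =>
    obtain ⟨l, rfl⟩ := hF
    refine ⟨∑ s, C (l ⟨monomial s.1 1, isHomogeneous_monomial 1 s.2⟩) * X s, fun q => ?_⟩
    have hq : q = ∑ s : {s : Fin m →₀ ℕ // s.degree = d}, coeff s.1 q.1 •
        (⟨monomial s.1 1, isHomogeneous_monomial 1 s.2⟩ : homogeneousSubmodule (Fin m) K d) := by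
      refine Subtype.ext ?_
      ext t
      simp only [Submodule.coe_sum, Submodule.coe_smul, coeff_sum, coeff_smul, coeff_monomial,
        smul_eq_mul, mul_ite, mul_one, mul_zero]
      by_cases ht : t.degree = d
      · rw [Finset.sum_eq_single ⟨t, ht⟩]
        · simp
        · intro b _ hb
          rw [if_neg fun h => hb (Subtype.ext h)]
        · simp
      · rw [Finset.sum_eq_zero fun b _ => if_neg fun h : b.1 = t => ht (h ▸ b.2)]
        exact IsHomogeneous.coeff_eq_zero q.2 ht
    conv_lhs => rw [hq]
    simp [coords, mul_comm]
  | algebraMap r => exact ⟨C r, fun q => by simp⟩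
  | add F G _ _ hF hG =>
    obtain ⟨f, hf⟩ := hF
    obtain ⟨g, hg⟩ := hG
    exact ⟨f + g, fun q => by simp [hf, hg]⟩
  | mul F G _ _ hF hG =>
    obtain ⟨f, hf⟩ := hF
    obtain ⟨g, hg⟩ := hG
    exact ⟨f * g, fun q => by simp [hf, hg]⟩

theorem exists_strengthLe_of_eval_constDerivation_ne_zero {K : Type} [Field K] [Infinite K]
    {d m : ℕ} (hd : d ≠ 0) (f : MvPolynomial {s : Fin m →₀ ℕ // s.degree = d} K)
    (w : Fin m → K) :
    ∃ N : ℕ, ∀ (n : ℕ) (q : MvPolynomial (Fin n) K), q.IsHomogeneous d →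
      (∀ φ : (Fin n → K) →ₗ[K] (Fin m → K), eval (coords d (polyMapAlg K φ q)) f = 0) →
      (∃ φ : (Fin n → K) →ₗ[K] (Fin m → K), eval (coords d (polyMapAlg K φ q))
        (constDerivation (coords d ((∑ j, w j • X j : MvPolynomial (Fin m) K) ^ d)) f) ≠ 0) →
      StrengthLe K d q N := by
  set u : MvPolynomial (Fin m) K := ∑ j, w j • X j with hu
  obtain ⟨N, hN⟩ := strengthLe_homogeneousComponent_aeval_sub hd (coords d (u ^ d)) f
  refine ⟨N, fun n q hq h0 => ?_⟩
  rintro ⟨φ, hφ⟩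
  have key := hN n q (fun i => coeff i.1 (pencil φ u q)) fun i =>
    homogeneousComponent_coeff_pencil φ u hq i.1
  have heval : ∀ l : Fin n → K, (fun i : {s : Fin m →₀ ℕ // s.degree = d} =>
      eval l (coeff i.1 (pencil φ u q))) =
      coords d (polyMapAlg K (φ + (Fintype.linearCombination K l).smulRight w) q) := by
    intro l
    funext i
    rw [coords, ← map_eval_pencil, coeff_map]
  have hG : aeval (fun i : {s : Fin m →₀ ℕ // s.degree = d} => coeff i.1 (pencil φ u q)) f = 0 := by
    refine MvPolynomial.funext fun l => ?_
    rw [map_zero, ← h0 (φ + (Fintype.linearCombination K l).smulRight w), ← heval l, aeval_def,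
      ← coe_eval₂Hom, ← RingHom.comp_apply, comp_eval₂Hom]
    have hC : (eval l).comp (algebraMap K (MvPolynomial (Fin n) K)) = RingHom.id K := by
      ext; simp [algebraMap_eq]
    rw [hC]
    rfl
  have hconst : (fun i : {s : Fin m →₀ ℕ // s.degree = d} =>
      constantCoeff (coeff i.1 (pencil φ u q))) = coords d (polyMapAlg K φ q) := by
    have h := heval 0
    have h0' : (Fintype.linearCombination K (0 : Fin n → K)).smulRight w = 0 := by
      ext; simp [Fintype.linearCombination_apply]
    rw [h0', add_zero] at h
    rw [← h, eval_zero]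
  rw [hG, hconst, map_zero, zero_sub] at key
  set a := eval (coords d (polyMapAlg K φ q))
    (constDerivation (coords d (u ^ d)) f)
  have h := key.C_mul (-a⁻¹)
  rwa [mul_neg, ← neg_mul, ← C_neg, neg_neg, ← mul_assoc, ← C_mul, inv_mul_cancel₀ hφ, C_1,
    one_mul] at h

theorem strengthLe_of_eval_coords_eq_zero {K : Type} [Field K] [PerfectField K] [Infinite K]
    {d m : ℕ} (hd : d ≠ 0) (hchar : ringChar K = 0 ∨ d < ringChar K) (D : ℕ) :
    ∀ (f : MvPolynomial {s : Fin m →₀ ℕ // s.degree = d} K), f ≠ 0 → f.totalDegree = D →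
    ∃ N : ℕ, ∀ (n : ℕ) (q : MvPolynomial (Fin n) K), q.IsHomogeneous d →
      (∀ φ : (Fin n → K) →ₗ[K] (Fin m → K), eval (coords d (polyMapAlg K φ q)) f = 0) →
      StrengthLe K d q N := by
  classical
  have := finite_degree_eq m d
  have := Fintype.ofFinite {s : Fin m →₀ ℕ // s.degree = d}
  induction D using Nat.strong_induction_on with
  | _ D ih =>
  intro f hf hD
  by_cases hD0 : D = 0
  · subst hD0
    rw [totalDegree_eq_zero_iff_eq_C] at hD
    refine ⟨0, fun n q _ h => absurd (h 0) ?_⟩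
    rw [hD, eval_C]
    exact fun h => hf (by rw [hD, h, C_0])
  by_cases hder : ∃ i, pderiv i f ≠ 0
  · obtain ⟨w, hw⟩ := exists_constDerivation_coords_pow_ne_zero hchar f hder
    obtain ⟨M, hM⟩ := ih _ (hD ▸ totalDegree_constDerivation_lt _ f hw) _ hw rfl
    obtain ⟨N, hN⟩ := exists_strengthLe_of_eval_constDerivation_ne_zero hd f w
    refine ⟨max M N, fun n q hq h => ?_⟩
    by_cases hφ : ∃ φ : (Fin n → K) →ₗ[K] (Fin m → K), eval (coords d (polyMapAlg K φ q))
        (constDerivation (coords d ((∑ j, w j • X j : MvPolynomial (Fin m) K) ^ d)) f) ≠ 0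
    · exact (hN n q hq h hφ).mono (le_max_right _ _)
    · push Not at hφ
      exact (hM n q hq hφ).mono (le_max_left _ _)
  · push Not at hder
    rcases CharP.char_is_prime_or_zero K (ringChar K) with hp | hp
    · have : Fact (ringChar K).Prime := ⟨hp⟩
      have : ExpChar K (ringChar K) := ExpChar.prime hp
      obtain ⟨g, rfl⟩ := exists_pow_of_pderiv_eq_zero (ringChar K) f hder
      have hg : g ≠ 0 := fun h => hf (by rw [h, zero_pow hp.ne_zero])
      have hlt : g.totalDegree < D := by
        obtain ⟨k, hk⟩ := Nat.exists_eq_add_of_le' hp.two_le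
        rw [hk, pow_succ, totalDegree_mul_of_isDomain (pow_ne_zero _ hg) hg, pow_succ,
          totalDegree_mul_of_isDomain (pow_ne_zero _ hg) hg] at hD
        omega
      obtain ⟨N, hN⟩ := ih _ hlt g hg rfl
      refine ⟨N, fun n q hq h => hN n q hq fun φ => ?_⟩
      have := h φ
      rw [map_pow] at this
      exact pow_eq_zero_iff hp.ne_zero |>.1 this
    · have : CharZero K := (CharP.ringChar_zero_iff_CharZero K).1 hp
      exact absurd (hD.symm.trans (totalDegree_eq_zero_of_pderiv_eq_zero f hder)) hD0

/-- **Theorem (main theorem for polynomials).** Fix `d ≥ 2` and let `K` be a perfect infinite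
field with `char K = 0` or `char K > d`. For every closed subset `X ⊊ S^d` there is an `N`
such that for every finite-dimensional vector space (i.e. every `K^n`), all elements of
`X(K^n)` have strength at most `N`. -/
theorem strength_bounded_of_closed_proper_Sd
    (K : Type) [Field K] [PerfectField K] [Infinite K]
    (d : ℕ) (hd : 2 ≤ d) (hchar : ringChar K = 0 ∨ d < ringChar K)
    (X : ClosedSubsetSd K d)
    (hX : ∃ n, X.carrier n ≠ {q : MvPolynomial (Fin n) K | q.IsHomogeneous d}) :
    ∃ N : ℕ, ∀ n : ℕ, ∀ q ∈ X.carrier n, StrengthLe K d q N := by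
  obtain ⟨m, hm⟩ := hX
  obtain ⟨S, hS, hSX⟩ := X.closed m
  have hex : ∃ q : homogeneousSubmodule (Fin m) K d,
      (q : MvPolynomial (Fin m) K) ∉ X.carrier m := by
    by_contra! h
    exact hm (Set.Subset.antisymm (fun q hq => X.homog m q hq) fun q hq => h ⟨q, hq⟩)
  obtain ⟨q₀, hq₀⟩ := hex
  have hq₀S : q₀ ∉ {x | ∀ F ∈ S, F x = 0} := hSX ▸ hq₀
  simp only [Set.mem_ofPred_eq, not_forall] at hq₀S
  obtain ⟨F, hFS, hF⟩ := hq₀S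
  obtain ⟨f, hf⟩ := exists_eval_coords_of_isPolyFun (hS F hFS)
  have hf0 : f ≠ 0 := by
    rintro rfl
    exact hF (by rw [hf, map_zero])
  obtain ⟨N, hN⟩ := strengthLe_of_eval_coords_eq_zero (by omega) hchar _ f hf0 rfl
  refine ⟨N, fun n q hq => hN n q (X.homog n q hq) fun φ => ?_⟩
  have hφ := X.map_mem φ q hq
  have hmem : (⟨polyMapAlg K φ q, X.homog m _ hφ⟩ : homogeneousSubmodule (Fin m) K d) ∈
      {x | ∀ F ∈ S, F x = 0} := by
    rw [← hSX]
    exact hφ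
  rw [← hf ⟨polyMapAlg K φ q, X.homog m _ hφ⟩]
  exact hmem F hFS

end
end

section
/- Fix an integer d ≥ 2 and let K be a perfect and infinite field with char K = 0 or char K > d. Let X be a closed subset of S^d and let U be a finite-dimensional K-vector space with X(U) ≠ S^d U. Then for all finite-dimensional K-vector spaces V, every element of X(V) has strength at most dim U + Σ_{i=1}^{⌊d/2⌋} dim S^{d−i} U, where dim S^{d−i} U is the binomial coefficient C(dim U + d − i − 1, d − i). -/
open MvPolynomial

noncomputable section

/-- The exponents of the monomials of degree `d` in `u` variables. -/
abbrev DegreeExponent (u d : ℕ) : Type := {α : Fin u →₀ ℕ // α.degree = d}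

instance (u d : ℕ) : Finite (DegreeExponent u d) :=
  (Finsupp.finite_of_degree_le d).subset fun _ h => le_of_eq h

instance (u d : ℕ) : Fintype (DegreeExponent u d) := Fintype.ofFinite _

theorem card_degreeExponent (u d : ℕ) :
    Fintype.card (DegreeExponent u d) = Nat.choose (u + d - 1) d := by
  rw [← Nat.multichoose_eq, ← Fintype.card_fin u, ← Sym.card_sym_eq_multichoose,
    Fintype.card_fin]
  exact (Fintype.card_congr ((Sym.equivNatSum (Fin u) d).trans
    (Equiv.subtypeEquivRight fun α => by rfl))).symm

/-- First order Taylor expansion, with remainder in the square of an ideal. -/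
theorem aeval_sub_aeval_sub_sum_pderiv_mem_sq {K R σ : Type*} [CommRing K] [CommRing R]
    [Algebra K R] [Fintype σ] (c e : σ → R) (E : Ideal R) (h : ∀ i, e i - c i ∈ E)
    (f : MvPolynomial σ K) :
    aeval e f - aeval c f - ∑ i, aeval c (pderiv i f) * (e i - c i) ∈ E ^ 2 := by
  classical
  induction f using MvPolynomial.induction_on with
  | C k => simp
  | add f g hf hg =>
    have := add_mem hf hg
    simp only [map_add, add_mul, Finset.sum_add_distrib]
    convert this using 1
    ring
  | mul_X f j hf =>
    have hE : aeval e f - aeval c f ∈ E := by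
      have h1 := add_mem (Ideal.pow_le_self two_ne_zero hf)
        (sum_mem fun i (_ : i ∈ Finset.univ) => E.mul_mem_left (aeval c (pderiv i f)) (h i))
      simpa using h1
    have h2 : (aeval e f - aeval c f) * (e j - c j) ∈ E ^ 2 := by
      rw [pow_two]
      exact Ideal.mul_mem_mul hE (h j)
    convert add_mem ((E ^ 2).mul_mem_right (c j) hf) h2 using 1
    have h3 : ∑ i, aeval c (pderiv i (f * X j)) * (e i - c i)
        = (∑ i, aeval c (pderiv i f) * (e i - c i)) * c j + aeval c f * (e j - c j) := by
      simp only [pderiv_mul, map_add, map_mul, aeval_X, add_mul, Finset.sum_add_distrib,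
        Finset.sum_mul, pderiv_X]
      congr 1
      · exact Finset.sum_congr rfl fun i _ => by ring
      · rw [Finset.sum_eq_single j]
        · simp
        · intro i _ hij
          simp [Pi.single_eq_of_ne hij.symm]
        · simp
    rw [h3]
    simp only [map_mul, aeval_X]
    ring

/-- Members of an ideal generated by homogeneous elements, degree by degree. -/
theorem exists_homogeneousComponent_eq_sum {K τ ι : Type*} [CommRing K] [Fintype ι]
    (g : ι → MvPolynomial τ K) (e : ι → ℕ) (hg : ∀ i, (g i).IsHomogeneous (e i)) (d : ℕ)
    (he : ∀ i, e i ≤ d) {p : MvPolynomial τ K} (hp : p ∈ Ideal.span (Set.range g)) :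
    ∃ s : ι → MvPolynomial τ K, (∀ i, (s i).IsHomogeneous (d - e i)) ∧
      homogeneousComponent d p = ∑ i, g i * s i := by
  obtain ⟨r, rfl⟩ := Ideal.mem_span_range_iff_exists_fun.1 hp
  refine ⟨fun i => homogeneousComponent (d - e i) (r i),
    fun i => homogeneousComponent_isHomogeneous _ _, ?_⟩
  rw [map_sum]
  refine Finset.sum_congr rfl fun i _ => ?_
  let _ : GradedAlgebra (homogeneousSubmodule τ K) := gradedAlgebra
  have h := DirectSum.coe_decompose_mul_of_right_mem_of_le (homogeneousSubmodule τ K)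
    (a := r i) (hg i) (he i)
  rw [mul_comm (g i)]
  exact (decomposition.decompose'_apply _ _).symm.trans
    (h.trans (congrArg (· * g i) (decomposition.decompose'_apply _ _)))

/-- `b` is homogeneous of degree `m` in both sets of variables taken together. -/
def IsBihomogeneous {K σ τ : Type*} [CommRing K] (m : ℕ) (b : MvPolynomial σ (MvPolynomial τ K)) :
    Prop :=
  ∀ β γ, coeff γ (coeff β b) ≠ 0 → β.degree + γ.degree = m

namespace IsBihomogeneous

variable {K σ τ : Type*} [CommRing K] {m k : ℕ} {b c : MvPolynomial σ (MvPolynomial τ K)}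

theorem add (hb : IsBihomogeneous m b) (hc : IsBihomogeneous m c) : IsBihomogeneous m (b + c) := by
  intro β γ h
  by_cases h1 : coeff γ (coeff β b) = 0
  · exact hc β γ (by simpa [h1] using h)
  · exact hb β γ h1

theorem sum {ι : Type*} (s : Finset ι) (f : ι → MvPolynomial σ (MvPolynomial τ K))
    (h : ∀ i ∈ s, IsBihomogeneous m (f i)) : IsBihomogeneous m (∑ i ∈ s, f i) :=
  Finset.sum_induction f (IsBihomogeneous m) (fun _ _ => add) (fun β γ h => by simp at h) h

theorem mul (hb : IsBihomogeneous m b) (hc : IsBihomogeneous k c) :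
    IsBihomogeneous (m + k) (b * c) := by
  classical
  intro β γ h
  rw [coeff_mul, coeff_sum] at h
  obtain ⟨⟨β₁, β₂⟩, hβ, h⟩ := Finset.exists_ne_zero_of_sum_ne_zero h
  rw [coeff_mul] at h
  obtain ⟨⟨γ₁, γ₂⟩, hγ, h⟩ := Finset.exists_ne_zero_of_sum_ne_zero h
  rw [Finset.HasAntidiagonal.mem_antidiagonal] at hβ
  rw [Finset.HasAntidiagonal.mem_antidiagonal] at hγ
  simp only at hβ hγ h
  rw [← hβ, ← hγ, map_add, map_add, ← hb _ _ (left_ne_zero_of_mul h),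
    ← hc _ _ (right_ne_zero_of_mul h)]
  ring

theorem algebraMap (r : K) :
    IsBihomogeneous 0 (algebraMap K (MvPolynomial σ (MvPolynomial τ K)) r) := by
  classical
  intro β γ h
  rw [MvPolynomial.algebraMap_apply, MvPolynomial.algebraMap_apply, coeff_C] at h
  split_ifs at h with h1
  · rw [coeff_C] at h
    split_ifs at h with h2
    · simp [← h1, ← h2]
    · simp at h
  · simp at h

theorem pow (hb : IsBihomogeneous m b) (k : ℕ) : IsBihomogeneous (m * k) (b ^ k) := by
  induction k with
  | zero => simpa using algebraMap (σ := σ) (τ := τ) (1 : K)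
  | succ k ih => rw [pow_succ, mul_add_one]; exact ih.mul hb

theorem prod {ι : Type*} (s : Finset ι) (f : ι → MvPolynomial σ (MvPolynomial τ K))
    (e : ι → ℕ) (h : ∀ i, IsBihomogeneous (e i) (f i)) :
    IsBihomogeneous (∑ i ∈ s, e i) (∏ i ∈ s, f i) := by
  classical
  induction s using Finset.induction_on with
  | empty => simpa using algebraMap (σ := σ) (τ := τ) (1 : K)
  | insert i s hi ih => rw [Finset.sum_insert hi, Finset.prod_insert hi]; exact (h i).mul ih

theorem aeval {ι : Type*} (f : ι → MvPolynomial σ (MvPolynomial τ K))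
    (hf : ∀ i, IsBihomogeneous 1 (f i)) {q : MvPolynomial ι K} (hq : q.IsHomogeneous m) :
    IsBihomogeneous m (MvPolynomial.aeval f q) := by
  rw [aeval_def, eval₂_eq]
  refine sum _ _ fun γ hγ => ?_
  have hdeg : m = 0 + ∑ i ∈ γ.support, γ i := by
    rw [zero_add, hq.degree_eq_sum_deg_support hγ]
  rw [hdeg]
  refine (algebraMap _).mul (prod _ _ _ fun i => ?_)
  simpa using (hf i).pow (γ i)

theorem isHomogeneous_coeff (hb : IsBihomogeneous m b) (β : σ →₀ ℕ) :
    (coeff β b).IsHomogeneous (m - β.degree) := by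
  intro γ hγ
  have h1 : Finsupp.weight (1 : τ → ℕ) γ = γ.degree := by
    rw [Finsupp.degree_eq_weight_one]; rfl
  have := hb β γ hγ
  omega

theorem degree_le (hb : IsBihomogeneous m b) {β : σ →₀ ℕ} (hβ : coeff β b ≠ 0) :
    β.degree ≤ m := by
  obtain ⟨γ, hγ⟩ := exists_coeff_ne_zero hβ
  have := hb β γ hγ
  omega

end IsBihomogeneous

theorem aeval_mul_of_isHomogeneous {K ι S : Type*} [CommRing K] [CommRing S] [Algebra K S]
    (v : ι → S) (w : S) {q : MvPolynomial ι K} {m : ℕ} (hq : q.IsHomogeneous m) :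
    aeval (fun i => v i * w) q = aeval v q * w ^ m := by
  rw [aeval_def, aeval_def, eval₂_eq, eval₂_eq, Finset.sum_mul]
  refine Finset.sum_congr rfl fun γ hγ => ?_
  simp_rw [mul_pow, Finset.prod_mul_distrib, Finset.prod_pow_eq_pow_sum]
  rw [← hq.degree_eq_sum_deg_support hγ, mul_assoc]

/-- The linear form with coefficient vector `x`. -/
def linForm {K : Type*} [CommRing K] {u : ℕ} (x : Fin u → K) : MvPolynomial (Fin u) K :=
  ∑ j, x j • X j

/-- Substitution of linear forms for the variables. -/
def linSubst {K : Type*} [CommRing K] {n u : ℕ} (a : Fin n → Fin u → K) :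
    MvPolynomial (Fin n) K →ₐ[K] MvPolynomial (Fin u) K :=
  aeval fun i => linForm (a i)

/-- The simultaneous substitution of `y i + linForm (a i)` for the `i`-th variable. -/
def shiftSubst {K : Type*} [CommRing K] {n u : ℕ} (a : Fin n → Fin u → K) :
    MvPolynomial (Fin n) K →ₐ[K] MvPolynomial (Fin u) (MvPolynomial (Fin n) K) :=
  aeval fun i => map C (linForm (a i)) + C (X i)

/-- The substitution obtained from `linSubst` by perturbing the linear map by the generic rank
one map with image spanned by `x`. -/
def rankOneSubst {K : Type*} [CommRing K] {n u : ℕ} (a : Fin n → Fin u → K) (x : Fin u → K) :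
    MvPolynomial (Fin n) K →ₐ[K] MvPolynomial (Fin u) (MvPolynomial (Fin n) K) :=
  aeval fun i => map C (linForm (a i)) + C (X i) * map C (linForm x)

section Substitution

variable {K : Type*} [CommRing K] {n u : ℕ} (a : Fin n → Fin u → K) (x : Fin u → K)

theorem isHomogeneous_linForm : (linForm x).IsHomogeneous 1 := by
  refine IsHomogeneous.sum _ _ _ fun j _ => ?_
  rw [smul_eq_C_mul]
  exact isHomogeneous_C_mul_X _ _

theorem isHomogeneous_linSubst {q : MvPolynomial (Fin n) K} {d : ℕ} (hq : q.IsHomogeneous d) :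
    (linSubst a q).IsHomogeneous d := by
  have h := hq.aeval _ fun i => isHomogeneous_linForm (a i)
  rwa [one_mul] at h

theorem isBihomogeneous_shiftSubst {q : MvPolynomial (Fin n) K} {d : ℕ}
    (hq : q.IsHomogeneous d) : IsBihomogeneous d (shiftSubst a q) := by
  classical
  refine IsBihomogeneous.aeval _ (fun i => IsBihomogeneous.add ?_ ?_) hq
  · intro β γ h
    rw [coeff_map, coeff_C] at h
    split_ifs at h with h1
    · have := isHomogeneous_linForm (a i) h
      rw [← h1, ← this, Finsupp.degree_eq_weight_one, map_zero, add_zero]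
      rfl
    · simp at h
  · intro β γ h
    rw [coeff_C] at h
    split_ifs at h with h1
    · rw [coeff_X] at h
      split_ifs at h with h2
      · simp [← h1, ← h2]
      · simp at h
    · simp at h

theorem coeff_zero_shiftSubst (q : MvPolynomial (Fin n) K) : coeff 0 (shiftSubst a q) = q := by
  have h : (constantCoeff (σ := Fin u) (R := MvPolynomial (Fin n) K)).comp
      (shiftSubst a).toRingHom = RingHom.id _ := by
    apply MvPolynomial.ringHom_ext
    · intro r
      simp [shiftSubst, MvPolynomial.algebraMap_apply]
    · intro i
      simp [shiftSubst, linForm, constantCoeff_eq, coeff_map, coeff_sum, coeff_smul,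
        coeff_zero_X]
  exact congrArg (fun f => f q) h

theorem map_constantCoeff_shiftSubst (q : MvPolynomial (Fin n) K) :
    map constantCoeff (shiftSubst a q) = linSubst a q := by
  have h : (map (constantCoeff (σ := Fin n) (R := K))).comp (shiftSubst a).toRingHom
      = (linSubst a).toRingHom := by
    apply MvPolynomial.ringHom_ext
    · intro r
      simp [shiftSubst, linSubst, MvPolynomial.algebraMap_apply]
    · intro i
      simp [shiftSubst, linSubst, map_map, constantCoeff_comp_C, map_id]
  exact congrArg (fun f => f q) h

theorem map_eval_rankOneSubst (y : Fin n → K) (q : MvPolynomial (Fin n) K) :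
    map (eval y) (rankOneSubst a x q) = linSubst (fun i j => a i j + y i * x j) q := by
  have h : (map (eval y)).comp (rankOneSubst a x).toRingHom
      = (linSubst fun i j => a i j + y i * x j).toRingHom := by
    apply MvPolynomial.ringHom_ext
    · intro r
      simp [rankOneSubst, linSubst, MvPolynomial.algebraMap_apply]
    · intro i
      simp [rankOneSubst, linSubst, linForm, add_smul, Finset.sum_add_distrib,
        Finset.mul_sum, smul_eq_C_mul, mul_assoc]
  exact congrArg (fun f => f q) h

/-- `rankOneSubst` is obtained from `shiftSubst` by rescaling the homogeneous coefficients. -/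
theorem rankOneSubst_eq_sum {q : MvPolynomial (Fin n) K} {d : ℕ} (hq : q.IsHomogeneous d) :
    rankOneSubst a x q = ∑ β ∈ (shiftSubst a q).support,
      C (coeff β (shiftSubst a q)) * map C (linForm x ^ (d - β.degree) * monomial β 1) := by
  have h : (eval₂Hom (aeval fun i => C (X i) * map C (linForm x) :
      MvPolynomial (Fin n) K →ₐ[K] MvPolynomial (Fin u) (MvPolynomial (Fin n) K)).toRingHom
      X).comp (shiftSubst a).toRingHom = (rankOneSubst a x).toRingHom := by
    apply MvPolynomial.ringHom_ext
    · intro r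
      simp [shiftSubst, rankOneSubst, MvPolynomial.algebraMap_apply]
    · intro i
      simp [shiftSubst, rankOneSubst, linForm, smul_eq_C_mul, MvPolynomial.algebraMap_apply]
  have h2 := congrArg (fun f => f q) h
  simp only [RingHom.comp_apply, AlgHom.toRingHom_eq_coe, RingHom.coe_coe, coe_eval₂Hom] at h2
  rw [← h2, eval₂_eq]
  refine Finset.sum_congr rfl fun β _ => ?_
  have h3 := aeval_mul_of_isHomogeneous
    (fun i => (C (X i) : MvPolynomial (Fin u) (MvPolynomial (Fin n) K))) (map C (linForm x))
    ((isBihomogeneous_shiftSubst a hq).isHomogeneous_coeff β)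
  have h4 : (aeval fun i => (C (X i) : MvPolynomial (Fin u) (MvPolynomial (Fin n) K)))
      (coeff β (shiftSubst a q)) = C (coeff β (shiftSubst a q)) := by
    generalize coeff β (shiftSubst a q) = r
    induction r using MvPolynomial.induction_on with
    | C r => simp [MvPolynomial.algebraMap_apply]
    | add p q hp hq => simp [hp, hq]
    | mul_X p i hp => simp [hp]
  rw [RingHom.coe_coe, h3, h4, map_mul, map_pow, map_monomial, map_one, mul_assoc, monomial_eq]
  simp [Finsupp.prod]

/-- The scalars relating the coefficients of `rankOneSubst` and `shiftSubst`. -/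
def rankOneScalar (d : ℕ) (α β : Fin u →₀ ℕ) : K :=
  coeff α (linForm x ^ (d - β.degree) * monomial β 1)

theorem coeff_rankOneSubst {q : MvPolynomial (Fin n) K} {d : ℕ} (hq : q.IsHomogeneous d)
    (α : Fin u →₀ ℕ) :
    coeff α (rankOneSubst a x q) = ∑ β ∈ (shiftSubst a q).support,
      C (rankOneScalar x d α β) * coeff β (shiftSubst a q) := by
  rw [rankOneSubst_eq_sum a x hq, coeff_sum]
  refine Finset.sum_congr rfl fun β _ => ?_
  rw [coeff_C_mul, coeff_map, mul_comm, rankOneScalar]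

theorem coeff_shiftSubst_of_degree_eq {q : MvPolynomial (Fin n) K} {d : ℕ}
    (hq : q.IsHomogeneous d) {α : Fin u →₀ ℕ} (hα : α.degree = d) :
    coeff α (shiftSubst a q) = C (coeff α (linSubst a q)) := by
  have h := (isBihomogeneous_shiftSubst a hq).isHomogeneous_coeff α
  rw [hα, Nat.sub_self, ← totalDegree_zero_iff_isHomogeneous] at h
  rw [← map_constantCoeff_shiftSubst, coeff_map, constantCoeff_eq]
  exact totalDegree_eq_zero_iff_eq_C.1 h

theorem homogeneousComponent_coeff_rankOneSubst {q : MvPolynomial (Fin n) K} {d : ℕ}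
    (hq : q.IsHomogeneous d) (α : Fin u →₀ ℕ) :
    homogeneousComponent d (coeff α (rankOneSubst a x q)) = C (coeff α (linForm x ^ d)) * q := by
  classical
  rw [coeff_rankOneSubst a x hq, map_sum]
  have hB := isBihomogeneous_shiftSubst a hq
  have h : ∀ β ∈ (shiftSubst a q).support,
      homogeneousComponent d (C (rankOneScalar x d α β) * coeff β (shiftSubst a q))
      = if 0 = β then C (coeff α (linForm x ^ d)) * q else 0 := by
    intro β hβ
    have hle := hB.degree_le (mem_support_iff.1 hβ)
    rw [homogeneousComponent_C_mul, homogeneousComponent_of_mem (hB.isHomogeneous_coeff β)]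
    split_ifs with h1 h2 h2
    · subst h2
      simp [rankOneScalar, coeff_zero_shiftSubst]
    · have : β.degree = 0 ∨ d = 0 := by omega
      rcases this with h3 | h3
      · exact absurd ((Finsupp.degree_eq_zero_iff β).1 h3).symm h2
      · exact absurd ((Finsupp.degree_eq_zero_iff β).1 (by omega)).symm h2
    · subst h2
      simp at h1
    · simp
  rw [Finset.sum_congr rfl h, Finset.sum_ite_eq]
  split_ifs with h0
  · rfl
  · rw [notMem_support_iff, coeff_zero_shiftSubst] at h0
    simp [h0]

theorem coeff_rankOneSubst_sub_mem {q : MvPolynomial (Fin n) K} {d : ℕ} (hq : q.IsHomogeneous d)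
    {α : Fin u →₀ ℕ} (hα : α.degree = d) (E : Ideal (MvPolynomial (Fin n) K))
    (hE : ∀ β : Fin u →₀ ℕ, β.degree < d → coeff β (shiftSubst a q) ∈ E) :
    coeff α (rankOneSubst a x q) - C (coeff α (linSubst a q)) ∈ E := by
  classical
  have h : C (coeff α (linSubst a q)) = ∑ β ∈ (shiftSubst a q).support,
      if α = β then coeff α (shiftSubst a q) else 0 := by
    rw [Finset.sum_ite_eq, ← coeff_shiftSubst_of_degree_eq a hq hα]
    split_ifs with h0
    · rfl
    · exact notMem_support_iff.1 h0
  rw [coeff_rankOneSubst a x hq, h, ← Finset.sum_sub_distrib]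
  refine sum_mem fun β hβ => ?_
  rcases ((isBihomogeneous_shiftSubst a hq).degree_le (mem_support_iff.1 hβ)).lt_or_eq with h1 | h1
  · have hne : α ≠ β := by
      rintro rfl
      exact h1.ne hα
    rw [if_neg hne, sub_zero]
    exact E.mul_mem_left _ (hE β h1)
  · rw [rankOneScalar, h1, Nat.sub_self, pow_zero, one_mul, coeff_monomial]
    by_cases h2 : α = β
    · subst h2
      simp
    · simp [h2, Ne.symm h2]

end Substitution

theorem strengthLe_of_fintype {K : Type} [Field K] {d n : ℕ} {ι : Type*} [Fintype ι]
    {q : MvPolynomial (Fin n) K} (e : ι → ℕ) (r s : ι → MvPolynomial (Fin n) K)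
    (h1 : ∀ i, 1 ≤ e i) (h2 : ∀ i, e i ≤ d - 1) (hr : ∀ i, (r i).IsHomogeneous (e i))
    (hs : ∀ i, (s i).IsHomogeneous (d - e i)) (hq : q = ∑ i, r i * s i) {N : ℕ}
    (hN : Fintype.card ι ≤ N) : StrengthLe K d q N := by
  let φ := (Fintype.equivFin ι).symm
  refine ⟨Fintype.card ι, hN, e ∘ φ, r ∘ φ, s ∘ φ, fun i => h1 _, fun i => h2 _, fun i => hr _,
    fun i => hs _, ?_⟩
  rw [hq]
  exact (Equiv.sum_comp φ fun i => r i * s i).symm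

theorem sup_pow_sq_le {R : Type*} [CommRing R] (I m : Ideal R) {k l : ℕ} (h : l ≤ k + k) :
    (I ⊔ m ^ k) ^ 2 ≤ I ⊔ m ^ l := by
  have h1 : m ^ k * m ^ k ≤ m ^ l := by
    rw [← pow_add]
    exact Ideal.pow_le_pow_right h
  rw [pow_two, Ideal.sup_mul, Ideal.mul_sup (m ^ k)]
  exact sup_le (Ideal.mul_le_left.trans le_sup_left)
    (sup_le (Ideal.mul_le_right.trans le_sup_left) (h1.trans le_sup_right))

theorem aeval_C_eq_C_eval {K σ τ : Type*} [CommRing K] (c : σ → K) (p : MvPolynomial σ K) :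
    aeval (fun i => (C (c i) : MvPolynomial τ K)) p = C (eval c p) := by
  induction p using MvPolynomial.induction_on with
  | C r => simp
  | add p q hp hq => rw [map_add, map_add, map_add, hp, hq]
  | mul_X p i hp => rw [map_mul, map_mul, map_mul, hp, aeval_X, eval_X]

theorem aeval_coeff_rankOneSubst_eq_zero {K : Type*} [Field K] [Infinite K] {d n u : ℕ}
    {q : MvPolynomial (Fin n) K} (f : MvPolynomial (DegreeExponent u d) K)
    (hvan : ∀ b : Fin n → Fin u → K, eval (fun α => coeff α.1 (linSubst b q)) f = 0)
    (a : Fin n → Fin u → K) (x : Fin u → K) :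
    aeval (fun α : DegreeExponent u d => coeff α.1 (rankOneSubst a x q)) f = 0 := by
  refine MvPolynomial.funext fun y => ?_
  rw [map_zero, ← hvan fun i j => a i j + y i * x j, ← map_eval_rankOneSubst]
  have h : (eval y).comp (aeval (R := K) fun α : DegreeExponent u d =>
      coeff α.1 (rankOneSubst a x q)).toRingHom
      = eval fun α : DegreeExponent u d =>
        coeff α.1 (map (eval y) (rankOneSubst a x q)) := by
    apply MvPolynomial.ringHom_ext
    · intro r
      simp
    · intro i
      simp [coeff_map]
  exact congrArg (fun F => F f) h

theorem strengthLe_of_directional_derivative_ne_zero {K : Type} [Field K] [Infinite K] {d : ℕ}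
    (hd : 2 ≤ d) {n u : ℕ} {q : MvPolynomial (Fin n) K} (hq : q.IsHomogeneous d)
    (f : MvPolynomial (DegreeExponent u d) K)
    (hvan : ∀ b : Fin n → Fin u → K, eval (fun α => coeff α.1 (linSubst b q)) f = 0)
    (a : Fin n → Fin u → K) (x : Fin u → K)
    (hne : ∑ α, coeff α.1 (linForm x ^ d) *
      eval (fun α => coeff α.1 (linSubst a q)) (pderiv α f) ≠ 0) :
    StrengthLe K d q (∑ i ∈ Finset.Icc 1 (d / 2), Nat.choose (u + d - i - 1) (d - i)) := by
  let ι := Σ i : Finset.Icc 1 (d / 2), DegreeExponent u (d - i)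
  have hi : ∀ i : Finset.Icc 1 (d / 2), 1 ≤ i.1 ∧ i.1 ≤ d / 2 := fun i => Finset.mem_Icc.1 i.2
  have hB := isBihomogeneous_shiftSubst a hq
  let g : ι → MvPolynomial (Fin n) K := fun i => coeff i.2.1 (shiftSubst a q)
  let e : ι → ℕ := fun i => i.1
  have hg : ∀ i, (g i).IsHomogeneous (e i) := by
    rintro ⟨i, β⟩
    have h := hB.isHomogeneous_coeff β.1
    rwa [β.2, Nat.sub_sub_self (by have := hi i; omega)] at h
  let I := Ideal.span (Set.range g)
  let m := idealOfVars (Fin n) K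
  let E := I ⊔ m ^ (d / 2 + 1)
  have hE : ∀ β : Fin u →₀ ℕ, β.degree < d → coeff β (shiftSubst a q) ∈ E := by
    intro β hβ
    by_cases h : d - β.degree ≤ d / 2
    · refine Ideal.mem_sup_left (Ideal.subset_span ?_)
      exact ⟨⟨⟨d - β.degree, Finset.mem_Icc.2 (by omega)⟩, ⟨β, by simp only; omega⟩⟩, rfl⟩
    · refine Ideal.mem_sup_right ((mem_pow_idealOfVars_iff' _ _).2 fun γ hγ => ?_)
      exact (hB.isHomogeneous_coeff β).coeff_eq_zero (by omega)
  have hEsq : E ^ 2 ≤ I ⊔ m ^ (d + 1) := sup_pow_sq_le I m (by omega)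
  have hvan' := aeval_coeff_rankOneSubst_eq_zero f hvan a x
  have hT := hEsq (aeval_sub_aeval_sub_sum_pderiv_mem_sq
    (fun α : DegreeExponent u d => (C (coeff α.1 (linSubst a q)) : MvPolynomial (Fin n) K))
    (fun α => coeff α.1 (rankOneSubst a x q)) E
    (fun α => coeff_rankOneSubst_sub_mem a x hq α.2 E hE) f)
  simp only [hvan', aeval_C_eq_C_eval, hvan a, map_zero, sub_zero, zero_sub] at hT
  obtain ⟨p, hp, w, hw, hpw⟩ := Submodule.mem_sup.1 (neg_mem hT)
  rw [neg_neg] at hpw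
  obtain ⟨s, hs, hps⟩ := exists_homogeneousComponent_eq_sum g e hg d
    (fun i => by have := hi i.1; simp only [e]; omega) hp
  have hw0 : homogeneousComponent d w = 0 :=
    homogeneousComponent_eq_zero' _ _ fun γ hγ => by
      have := (mem_pow_idealOfVars_iff _ _).1 hw γ hγ
      omega
  have hmain := congrArg (homogeneousComponent d) hpw
  rw [map_add, hw0, add_zero, hps, map_sum] at hmain
  have hterm : ∀ α : DegreeExponent u d,
      homogeneousComponent d (C (eval (fun α => coeff α.1 (linSubst a q)) (pderiv α f)) *
        (coeff α.1 (rankOneSubst a x q) - C (coeff α.1 (linSubst a q)))) =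
      C (coeff α.1 (linForm x ^ d) *
        eval (fun α => coeff α.1 (linSubst a q)) (pderiv α f)) * q := by
    intro α
    rw [homogeneousComponent_C_mul, map_sub, homogeneousComponent_coeff_rankOneSubst a x hq,
      homogeneousComponent_of_mem (isHomogeneous_C (Fin n) (coeff α.1 (linSubst a q))),
      if_neg (by omega), sub_zero, map_mul]
    ring
  simp only [hterm] at hmain
  rw [← Finset.sum_mul, ← map_sum] at hmain
  set h := ∑ α, coeff α.1 (linForm x ^ d) *
      eval (fun α => coeff α.1 (linSubst a q)) (pderiv α f)
  refine strengthLe_of_fintype e g (fun i => C h⁻¹ * s i) (fun i => (hi i.1).1)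
    (fun i => by have := hi i.1; simp only [e]; omega) hg (fun i => (hs i).C_mul _) ?_ ?_
  · have h3 : C h⁻¹ * ∑ i, g i * s i = q := by
      rw [hmain, ← mul_assoc, ← map_mul, inv_mul_cancel₀ hne, map_one, one_mul]
    rw [← h3, Finset.mul_sum]
    exact Finset.sum_congr rfl fun i _ => by ring
  · rw [Fintype.card_sigma]
    refine le_of_eq ((Finset.sum_congr rfl fun i _ => ?_).trans
      (Finset.sum_coe_sort (Finset.Icc 1 (d / 2)) fun i => Nat.choose (u + d - i - 1) (d - i)))
    have := hi i
    rw [card_degreeExponent, show u + (d - i.1) - 1 = u + d - i.1 - 1 by omega]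

theorem exists_sum_coeff_linForm_pow_mul_pderiv_ne_zero {K : Type*} [Field K] [Infinite K]
    {d : ℕ} (hfac : (d.factorial : K) ≠ 0) {u : ℕ} (f : MvPolynomial (DegreeExponent u d) K)
    {α₀ : DegreeExponent u d} (h : pderiv α₀ f ≠ 0) :
    ∃ x : Fin u → K, ∑ α, C (coeff α.1 (linForm x ^ d)) * pderiv α f ≠ 0 := by
  classical
  by_contra! hx
  obtain ⟨γ, hγ⟩ := exists_coeff_ne_zero h
  let P : MvPolynomial (Fin u) K := ∑ α : DegreeExponent u d,
    monomial α.1 (α.1.multinomial * coeff γ (pderiv α f))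
  have hP : P = 0 := by
    refine MvPolynomial.funext fun x => ?_
    have h1 := congrArg (coeff γ) (hx x)
    rw [coeff_sum, coeff_zero] at h1
    rw [map_zero, ← h1, map_sum]
    refine Finset.sum_congr rfl fun α _ => ?_
    have h2 := coeff_linearCombination_X_pow (R := K)
      ((Finsupp.linearEquivFunOnFinite K K (Fin u)).symm x) α.1 d
    rw [if_pos (by exact α.2), Finsupp.linearCombination_eq_fintype_linearCombination_apply,
      Fintype.linearCombination_apply] at h2
    rw [coeff_C_mul, linForm]
    rw [h2, eval_monomial]
    have h3 : ∀ r, (Finsupp.linearEquivFunOnFinite K K (Fin u)).symm x r = x r := fun r => rfl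
    simp only [h3]
    ring
  have h1 : coeff α₀.1 P = α₀.1.multinomial * coeff γ (pderiv α₀ f) := by
    simp only [P, coeff_sum, coeff_monomial]
    rw [Finset.sum_eq_single α₀]
    · simp
    · intro β _ hβ
      rw [if_neg fun h => hβ (Subtype.ext h)]
    · simp
  rw [hP, coeff_zero] at h1
  rcases mul_eq_zero.1 h1.symm with h2 | h2
  · apply hfac
    have h3 := Nat.multinomial_spec α₀.1.support α₀.1
    have h4 : ∑ i ∈ α₀.1.support, α₀.1 i = d := α₀.2
    rw [h4] at h3
    rw [← h3, Nat.cast_mul]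
    exact mul_eq_zero_of_right _ h2
  · exact hγ h2

/-- A nonconstant polynomial all of whose derivatives vanish is a proper power over a perfect
field. -/
theorem exists_eq_pow_of_forall_pderiv_eq_zero {K σ : Type*} [Field K] [PerfectField K]
    (f : MvPolynomial σ K) (h : ∀ i, pderiv i f = 0) (hf : f.totalDegree ≠ 0) :
    ∃ (p : ℕ) (g : MvPolynomial σ K), f = g ^ p ∧ g.totalDegree < f.totalDegree := by
  classical
  have hcast : ∀ γ ∈ f.support, ∀ i, ((γ i : ℕ) : K) = 0 := by
    intro γ hγ i
    by_cases hi : γ i = 0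
    · simp [hi]
    have h1 := congrArg (coeff (γ - Finsupp.single i 1)) (h i)
    have hle : Finsupp.single i 1 ≤ γ := by
      rw [Finsupp.single_le_iff]
      omega
    rw [coeff_pderiv, tsub_add_cancel_of_le hle, coeff_zero] at h1
    have h2 := (mul_eq_zero.1 h1).resolve_left (mem_support_iff.1 hγ)
    rw [← Nat.cast_add_one] at h2
    convert h2 using 2
    simp only [Finsupp.coe_tsub, Pi.sub_apply, Finsupp.single_eq_same]
    omega
  obtain ⟨p, hp⟩ := ExpChar.exists K
  rcases hp with _ | hprime
  · refine absurd ?_ hf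
    rw [totalDegree_eq_zero_iff]
    exact fun γ hγ i => Nat.cast_eq_zero.1 (hcast γ hγ i)
  · have : Fact p.Prime := ⟨hprime⟩
    have : ExpChar K p := ExpChar.prime hprime
    have : PerfectRing K p := PerfectField.toPerfectRing p
    let g : MvPolynomial σ K := ∑ γ ∈ f.support,
      monomial (γ.mapRange (· / p) (Nat.zero_div p)) ((frobeniusEquiv K p).symm (coeff γ f))
    have hg : f = g ^ p := by
      have h1 : g ^ p = ∑ γ ∈ f.support, (monomial (γ.mapRange (· / p) (Nat.zero_div p))
          ((frobeniusEquiv K p).symm (coeff γ f))) ^ p := sum_pow_char p _ _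
      rw [h1]
      conv_lhs => rw [f.as_sum]
      refine Finset.sum_congr rfl fun γ hγ => ?_
      rw [monomial_pow, ← frobenius_def, frobenius_apply_frobeniusEquiv_symm]
      have hγp : p • γ.mapRange (· / p) (Nat.zero_div p) = γ := by
        ext i
        have := (CharP.cast_eq_zero_iff K p _).1 (hcast γ hγ i)
        simp [Nat.mul_div_cancel' this]
      rw [hγp]
    refine ⟨p, g, hg, ?_⟩
    have hdeg : f.totalDegree = g.totalDegree * p := by
      rw [hg, ← map_frobenius_expand p, ← totalDegree_expand]
      simp only [totalDegree, support_map_of_injective _ (frobenius_inj K p)]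
    have := hprime.two_le
    have : g.totalDegree ≠ 0 := fun h => hf (by rw [hdeg, h, zero_mul])
    rw [hdeg]
    nlinarith [Nat.pos_of_ne_zero this]

theorem totalDegree_pderiv_lt {K σ : Type*} [CommRing K] (f : MvPolynomial σ K) (i : σ)
    (hf : f.totalDegree ≠ 0) : (pderiv i f).totalDegree < f.totalDegree := by
  classical
  rw [totalDegree, Finset.sup_lt_iff (Nat.pos_of_ne_zero hf)]
  intro γ hγ
  rw [mem_support_iff, coeff_pderiv] at hγ
  have h := le_totalDegree (mem_support_iff.2 (left_ne_zero_of_mul hγ))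
  rw [Finsupp.sum_add_index' (by simp) (by simp)] at h
  simpa using h

/-- The strength bound for a form all of whose linear images in `u` variables satisfy a nontrivial
polynomial equation. -/
theorem strengthLe_of_eval_linSubst_eq_zero {K : Type} [Field K] [PerfectField K] [Infinite K]
    {d : ℕ} (hd : 2 ≤ d) (hfac : (d.factorial : K) ≠ 0) {n u : ℕ} {q : MvPolynomial (Fin n) K}
    (hq : q.IsHomogeneous d) (f : MvPolynomial (DegreeExponent u d) K) (hf : f ≠ 0)
    (hvan : ∀ b : Fin n → Fin u → K, eval (fun α => coeff α.1 (linSubst b q)) f = 0) :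
    StrengthLe K d q (∑ i ∈ Finset.Icc 1 (d / 2), Nat.choose (u + d - i - 1) (d - i)) := by
  induction hN : f.totalDegree using Nat.strong_induction_on generalizing f with
  | _ N ih =>
  subst hN
  by_cases hconst : f.totalDegree = 0
  · rw [totalDegree_eq_zero_iff_eq_C] at hconst
    have h := hvan 0
    rw [hconst, eval_C] at h
    rw [h, map_zero] at hconst
    exact absurd hconst hf
  by_cases hder : ∀ α, pderiv α f = 0
  · obtain ⟨p, g, hg, hlt⟩ := exists_eq_pow_of_forall_pderiv_eq_zero f hder hconst
    refine ih _ hlt g ?_ (fun b => ?_) rfl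
    · rintro rfl
      rcases eq_or_ne p 0 with rfl | hp
      · simp [hg] at hconst
      · exact hf (by rw [hg, zero_pow hp])
    · have h := hvan b
      rw [hg, map_pow] at h
      exact eq_zero_of_pow_eq_zero h
  · push Not at hder
    obtain ⟨α₀, hα₀⟩ := hder
    obtain ⟨x, hx⟩ := exists_sum_coeff_linForm_pow_mul_pderiv_ne_zero hfac f hα₀
    by_cases hvan' : ∀ b : Fin n → Fin u → K, eval (fun α => coeff α.1 (linSubst b q))
        (∑ α, C (coeff α.1 (linForm x ^ d)) * pderiv α f) = 0
    · refine ih _ ?_ _ hx hvan' rfl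
      refine (totalDegree_finsetSum _ _).trans_lt
        ((Finset.sup_lt_iff (Nat.pos_of_ne_zero hconst)).2 fun α _ => ?_)
      refine (totalDegree_mul _ _).trans_lt ?_
      rw [totalDegree_C, zero_add]
      exact totalDegree_pderiv_lt f α hconst
    · push Not at hvan'
      obtain ⟨a, ha⟩ := hvan'
      refine strengthLe_of_directional_derivative_ne_zero hd hq f hvan a x ?_
      simpa only [map_sum, map_mul, eval_C] using ha

/-- Polynomial functions on `S^d K^u` are polynomials in the coefficients. -/
theorem IsPolyFun.exists_eval_coeff {K : Type} [Field K] {d u : ℕ}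
    {F : homogeneousSubmodule (Fin u) K d → K} (hF : IsPolyFun K F) :
    ∃ f : MvPolynomial (DegreeExponent u d) K,
      ∀ p : homogeneousSubmodule (Fin u) K d,
        F p = eval (fun α => coeff α.1 (p : MvPolynomial (Fin u) K)) f := by
  classical
  refine Algebra.adjoin_induction (p := fun F _ => ∃ f : MvPolynomial (DegreeExponent u d) K,
      ∀ p : homogeneousSubmodule (Fin u) K d,
        F p = eval (fun α => coeff α.1 (p : MvPolynomial (Fin u) K)) f) ?_ ?_ ?_ ?_ hF
  · rintro _ ⟨l, rfl⟩
    let v : DegreeExponent u d → homogeneousSubmodule (Fin u) K d := fun α =>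
      ⟨monomial α.1 1, isHomogeneous_monomial 1 α.2⟩
    refine ⟨∑ α, C (l (v α)) * X α, fun p => ?_⟩
    have hp : p = ∑ α : DegreeExponent u d, coeff α.1 (p : MvPolynomial (Fin u) K) • v α := by
      apply Subtype.ext
      ext β
      simp only [v, Submodule.coe_sum, Submodule.coe_smul, coeff_sum, coeff_smul, coeff_monomial,
        smul_eq_mul, mul_ite, mul_one, mul_zero]
      by_cases hβ : β.degree = d
      · rw [Finset.sum_eq_single ⟨β, hβ⟩]
        · simp
        · intro α _ hα
          rw [if_neg fun h => hα (Subtype.ext h)]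
        · simp
      · rw [IsHomogeneous.coeff_eq_zero p.2 hβ, Finset.sum_eq_zero]
        intro α _
        rw [if_neg]
        rintro rfl
        exact hβ α.2
    conv_lhs => rw [hp]
    simp [mul_comm]
  · exact fun r => ⟨C r, fun p => by simp⟩
  · rintro F G _ _ ⟨f, hf⟩ ⟨g, hg⟩
    exact ⟨f + g, fun p => by simp [hf, hg]⟩
  · rintro F G _ _ ⟨f, hf⟩ ⟨g, hg⟩
    exact ⟨f * g, fun p => by simp [hf, hg]⟩

theorem linSubst_eq_polyMapAlg {K : Type} [Field K] {n u : ℕ} (b : Fin n → Fin u → K) :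
    linSubst b = polyMapAlg K (Fintype.linearCombination K b) := by
  rw [linSubst, polyMapAlg]
  simp [linForm, Fintype.linearCombination_apply_single]

theorem factorial_cast_ne_zero {K : Type*} [Field K] {d : ℕ}
    (hchar : ringChar K = 0 ∨ d < ringChar K) : (d.factorial : K) ≠ 0 := by
  intro h
  rw [ringChar.spec] at h
  rcases hchar with h0 | hlt
  · rw [h0, zero_dvd_iff] at h
    exact d.factorial_ne_zero h
  · have hp : (ringChar K).Prime :=
      (CharP.char_is_prime_or_zero K (ringChar K)).resolve_right (by omega)
    exact absurd ((hp.dvd_factorial).1 h) (by omega)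

/-- **Theorem (explicit bound, Remark `re:Explicit`).** Fix `d ≥ 2` and let `K` be a perfect
infinite field with `char K = 0` or `char K > d`. Let `X` be a closed subset of `S^d` and let
`U = K^u` be a finite-dimensional vector space with `X(U) ≠ S^d U`. Then for every `n`, every
element of `X(K^n)` has strength at most
`dim U + ∑_{i=1}^{⌊d/2⌋} dim S^{d-i} U`, where `dim S^{d-i} U = C(u + d - i - 1, d - i)`. -/
theorem strength_le_explicit_bound_Sd
    (K : Type) [Field K] [PerfectField K] [Infinite K]
    (d : ℕ) (hd : 2 ≤ d) (hchar : ringChar K = 0 ∨ d < ringChar K)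
    (X : ClosedSubsetSd K d) (u : ℕ)
    (hU : X.carrier u ≠ {q : MvPolynomial (Fin u) K | q.IsHomogeneous d}) :
    ∀ n : ℕ, ∀ q ∈ X.carrier n,
      StrengthLe K d q
        (u + ∑ i ∈ Finset.Icc 1 (d / 2), Nat.choose (u + d - i - 1) (d - i)) := by
  intro n q hq
  obtain ⟨S, hS, hcl⟩ := X.closed u
  obtain ⟨q₀, hq₀, hq₀X⟩ : ∃ q₀ : MvPolynomial (Fin u) K,
      q₀.IsHomogeneous d ∧ q₀ ∉ X.carrier u := by
    by_contra! h
    exact hU (Set.Subset.antisymm (X.homog u) h)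
  have hmem : ∀ p : homogeneousSubmodule (Fin u) K d,
      (p : MvPolynomial (Fin u) K) ∈ X.carrier u ↔ ∀ F ∈ S, F p = 0 := fun p =>
    Set.ext_iff.1 hcl p
  obtain ⟨F, hFS, hF⟩ : ∃ F ∈ S, F ⟨q₀, hq₀⟩ ≠ 0 := by
    by_contra! h
    exact hq₀X ((hmem ⟨q₀, hq₀⟩).2 h)
  obtain ⟨f, hf⟩ := (hS F hFS).exists_eval_coeff
  have hqd := X.homog n q hq
  obtain ⟨k, hk, hdec⟩ := strengthLe_of_eval_linSubst_eq_zero hd (factorial_cast_ne_zero hchar)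
    hqd f (by rintro rfl; exact hF (by rw [hf, map_zero])) fun b => by
      have h1 : linSubst b q ∈ X.carrier u := by
        rw [linSubst_eq_polyMapAlg]
        exact X.map_mem _ q hq
      rw [← (hmem ⟨linSubst b q, isHomogeneous_linSubst b hqd⟩).1 h1 F hFS, hf]
  exact ⟨k, hk.trans (Nat.le_add_left _ _), hdec⟩

end
end
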